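/- Let m, p, r be positive integers with p dividing m. Then APS(m, p, 2r) = APS(m, 2r); that is, every admissible pinnacle set of Z_m ≀ S_{2r} admits a witness in the complex reflection group G(m, p, 2r). -/

import Mathlib

open Finset

/-- `Prec p q` means the colored symbol `p = ξ^{p.1}(p.2)` precedes (is smaller than)
`q = ξ^{q.1}(q.2)`: `a > b`, or (`a = b` and `x > y`). -/
def Prec (p q : ℕ × ℕ) : Prop :=
  q.1 < p.1 ∨ (p.1 = q.1 ∧ q.2 < p.2)

instance : DecidableRel Prec := fun p q => by
  unfold Prec; infer_instance

/-- `w : ℕ → ℕ × ℕ` (read on positions `1,…,n`) is an element of `Z_m ≀ S_n`: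
each entry has color `< m` and norm in `{1,…,n}`, and the norms are pairwise distinct. -/
def IsGenPerm (m n : ℕ) (w : ℕ → ℕ × ℕ) : Prop :=
  (∀ i ∈ Finset.Icc 1 n, (w i).1 < m ∧ (w i).2 ∈ Finset.Icc 1 n) ∧
    Set.InjOn (fun i => (w i).2) (Set.Icc 1 n)

/-- The pinnacle set of the word `w`: values at interior positions `2 ≤ i ≤ n-1`
that strictly dominate both neighbors. -/
def pin (n : ℕ) (w : ℕ → ℕ × ℕ) : Finset (ℕ × ℕ) :=
  ((Finset.Icc 2 (n - 1)).filter
      (fun i => Prec (w (i - 1)) (w i) ∧ Prec (w (i + 1)) (w i))).image w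

/-- `P` is an admissible pinnacle set for `Z_m ≀ S_n`. -/
def IsAdmissible (m n : ℕ) (P : Finset (ℕ × ℕ)) : Prop :=
  ∃ w, IsGenPerm m n w ∧ pin n w = P

/-- `APS m n d` : admissible pinnacle sets for `Z_m ≀ S_n` of cardinality at most `d`. -/
def APS (m n d : ℕ) : Set (Finset (ℕ × ℕ)) :=
  {P | IsAdmissible m n P ∧ P.card ≤ d}

/-- The color sum `ε_w = e_1 + ⋯ + e_n` of a word `w`. -/
def epsSum (n : ℕ) (w : ℕ → ℕ × ℕ) : ℕ :=
  ∑ i ∈ Finset.Icc 1 n, (w i).1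

/-- `APSc m p n d` : sets `P` with `#P ≤ d` admitting a witness in the complex
reflection group `G(m,p,n) = {w ∈ Z_m ≀ S_n : ε_w ≡ 0 (mod p)}`. -/
def APSc (m p n d : ℕ) : Set (Finset (ℕ × ℕ)) :=
  {P | (∃ w, IsGenPerm m n w ∧ p ∣ epsSum n w ∧ pin n w = P) ∧ P.card ≤ d}

theorem Prec.trans {a b c : ℕ × ℕ} (hab : Prec a b) (hbc : Prec b c) : Prec a c := by
  unfold Prec at *; omega

theorem Prec.asymm {a b : ℕ × ℕ} (hab : Prec a b) : ¬ Prec b a := by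
  unfold Prec at *; omega

theorem Prec.total_of_snd_ne {a b : ℕ × ℕ} (h : a.2 ≠ b.2) : Prec a b ∨ Prec b a := by
  unfold Prec; omega

/-- The list of entries that strictly dominate both neighbours, in order of occurrence. -/
def pinnacles : List (ℕ × ℕ) → List (ℕ × ℕ)
  | a :: b :: c :: l =>
    if Prec a b ∧ Prec c b then b :: pinnacles (b :: c :: l) else pinnacles (b :: c :: l)
  | _ => []

theorem pinnacles_cons_of_not_prec {a b : ℕ × ℕ} (h : ¬ Prec a b) (l : List (ℕ × ℕ)) :
    pinnacles (a :: b :: l) = pinnacles (b :: l) := by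
  cases l <;> simp [pinnacles, h]

/-- Any symbol can be inserted into any word without changing its pinnacles. -/
theorem exists_insert_pinnacles_eq (x a : ℕ × ℕ) (l : List (ℕ × ℕ)) :
    ∃ y v, (y :: v).Perm (x :: a :: l) ∧ pinnacles (y :: v) = pinnacles (a :: l) ∧
      (y = x ∨ y = a) := by
  induction l generalizing a with
  | nil => exact ⟨x, [a], .refl _, rfl, .inl rfl⟩
  | cons b l ih =>
    by_cases h : Prec x a ∧ Prec b a
    · obtain ⟨y, v, hperm, hpin, hy⟩ := ih b
      have hya : ¬ Prec a y := by
        rcases hy with rfl | rfl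
        exacts [h.1.asymm, h.2.asymm]
      refine ⟨a, y :: v, (hperm.cons a).trans (.swap ..), ?_, .inr rfl⟩
      rw [pinnacles_cons_of_not_prec hya, pinnacles_cons_of_not_prec h.2.asymm, hpin]
    · exact ⟨x, a :: b :: l, .refl _, by simp [pinnacles, h], .inl rfl⟩

/-- A nonempty word of even length with distinct norms has an entry whose removal does not
change the pinnacles. -/
theorem exists_remove_pinnacles_eq (a b : ℕ × ℕ) (l : List (ℕ × ℕ)) (hl : Even l.length)
    (hnodup : ((a :: b :: l).map Prod.snd).Nodup) :
    ∃ x y v, (x :: y :: v).Perm (a :: b :: l) ∧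
      pinnacles (y :: v) = pinnacles (a :: b :: l) ∧ (y = a ∨ Prec y a) := by
  match l with
  | [] => exact ⟨b, a, [], .swap .., rfl, .inl rfl⟩
  | [c] => simp at hl
  | c :: d :: l =>
    have hab : a.2 ≠ b.2 := by
      simp only [List.map_cons, List.nodup_cons, List.mem_cons] at hnodup; tauto
    have hbc : b.2 ≠ c.2 := by
      simp only [List.map_cons, List.nodup_cons, List.mem_cons] at hnodup; tauto
    rcases Prec.total_of_snd_ne hab with hab | hba
    · rcases Prec.total_of_snd_ne hbc with hbc | hcb
      · refine ⟨b, a, c :: d :: l, .swap .., ?_, .inl rfl⟩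
        simp [pinnacles, hab.trans hbc, hbc, hbc.asymm]
      · obtain ⟨x, y, v, hperm, hpin, hy⟩ := exists_remove_pinnacles_eq c d l
          (by simpa [Nat.even_add_one] using hl)
          (by simpa using (List.nodup_cons.mp (List.nodup_cons.mp hnodup).2).2)
        have hyb : Prec y b := by
          rcases hy with rfl | hy
          exacts [hcb, hy.trans hcb]
        refine ⟨x, a, b :: y :: v, ?_, ?_, .inl rfl⟩
        · exact ((List.Perm.swap a x _).trans ((List.Perm.swap b x _).cons a)).trans
            ((hperm.cons b).cons a)
        · have h₁ : pinnacles (a :: b :: y :: v) = b :: pinnacles (b :: y :: v) := by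
            rw [pinnacles, if_pos ⟨hab, hyb⟩]
          have h₂ : pinnacles (a :: b :: c :: d :: l) = b :: pinnacles (b :: c :: d :: l) := by
            rw [pinnacles, if_pos ⟨hab, hcb⟩]
          rw [h₁, h₂, pinnacles_cons_of_not_prec hyb.asymm,
            pinnacles_cons_of_not_prec hcb.asymm, hpin]
    · exact ⟨a, b, c :: d :: l, .refl _, (pinnacles_cons_of_not_prec hba.asymm _).symm, .inr hba⟩
termination_by l.length

theorem mem_pinnacles {x : ℕ × ℕ} {l : List (ℕ × ℕ)} :
    x ∈ pinnacles l ↔ ∃ i, i + 2 < l.length ∧ Prec (l.getD i 0) (l.getD (i + 1) 0) ∧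
      Prec (l.getD (i + 2) 0) (l.getD (i + 1) 0) ∧ l.getD (i + 1) 0 = x := by
  induction l with
  | nil => simp [pinnacles]
  | cons a l ih =>
    match l with
    | [] => simp [pinnacles]
    | [b] => simp [pinnacles]
    | b :: c :: l =>
      rw [← Nat.or_exists_add_one]
      simp only [List.getD_cons_succ, List.length_cons, Nat.add_lt_add_iff_right] at ih ⊢
      rw [← ih, pinnacles]
      split_ifs with h
      · simp [h, eq_comm]
      · simp only [List.getD_cons_zero]
        tauto

/-- The entries `w 1, …, w n` as a list. -/
def wordList (n : ℕ) (w : ℕ → ℕ × ℕ) : List (ℕ × ℕ) :=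
  (List.range n).map fun i => w (i + 1)

theorem wordList_getD (l : List (ℕ × ℕ)) :
    wordList l.length (fun i => l.getD (i - 1) 0) = l := by
  apply List.ext_getElem <;> simp +contextual [wordList]

theorem toFinset_pinnacles_wordList (n : ℕ) (w : ℕ → ℕ × ℕ) :
    (pinnacles (wordList n w)).toFinset = pin n w := by
  have hget : ∀ i < n, (wordList n w).getD i 0 = w (i + 1) := by
    intro i hi
    simp [wordList, hi]
  ext x
  simp only [List.mem_toFinset, mem_pinnacles, pin, mem_image, mem_filter, mem_Icc]
  have hlen : (wordList n w).length = n := by simp [wordList]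
  rw [hlen]
  constructor
  · rintro ⟨i, hi, h₁, h₂, rfl⟩
    rw [hget _ (by omega), hget _ (by omega)] at h₁ h₂
    exact ⟨i + 2, ⟨by omega, h₁, h₂⟩, (hget _ (by omega)).symm⟩
  · rintro ⟨i, ⟨hi, h₁, h₂⟩, rfl⟩
    obtain ⟨j, rfl⟩ : ∃ j, i = j + 2 := ⟨i - 2, by omega⟩
    refine ⟨j, by omega, ?_⟩
    rw [hget _ (by omega), hget _ (by omega), hget _ (by omega)]
    exact ⟨h₁, h₂, rfl⟩

theorem sum_wordList (n : ℕ) (w : ℕ → ℕ × ℕ) :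
    ((wordList n w).map Prod.fst).sum = epsSum n w := by
  rw [epsSum, ← Finset.Ico_add_one_right_eq_Icc, Finset.sum_Ico_eq_sum_range]
  simp [wordList, Function.comp_def, add_comm, Finset.sum, Finset.range, Multiset.range]

theorem isGenPerm_iff_wordList (m n : ℕ) (w : ℕ → ℕ × ℕ) :
    IsGenPerm m n w ↔
      (∀ a ∈ wordList n w, a.1 < m ∧ a.2 ∈ Finset.Icc 1 n) ∧
        ((wordList n w).map Prod.snd).Nodup := by
  have hmem : ∀ q : ℕ → Prop, (∀ i ∈ Finset.Icc 1 n, q i) ↔ ∀ i < n, q (i + 1) := by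
    intro q
    refine ⟨fun h i hi => h _ (by simp; omega), fun h i hi => ?_⟩
    obtain ⟨h₁, h₂⟩ := Finset.mem_Icc.mp hi
    simpa [Nat.sub_add_cancel h₁] using h (i - 1) (by omega)
  rw [IsGenPerm, hmem]
  refine and_congr (by simp [wordList]) ?_
  rw [wordList, List.map_map, List.nodup_map_iff_inj_on List.nodup_range]
  constructor
  · intro h i hi j hj hij
    rw [List.mem_range] at hi hj
    have := h (Set.mem_Icc.mpr ⟨by omega, by omega⟩) (Set.mem_Icc.mpr ⟨by omega, by omega⟩) hij
    omega
  · rintro h i ⟨hi₁, hi₂⟩ j ⟨hj₁, hj₂⟩ hij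
    have := h (i - 1) (by simp; omega) (j - 1) (by simp; omega)
      (by simpa [Nat.sub_add_cancel hi₁, Nat.sub_add_cancel hj₁] using hij)
    omega

/-- A nonempty word of even length with distinct norms can be changed, by moving and recolouring
a single entry, into one with the same pinnacles and with colour sum divisible by `m`. -/
theorem exists_dvd_sum_pinnacles_eq {m n : ℕ} (hm : 1 ≤ m) {l : List (ℕ × ℕ)} (hne : l ≠ [])
    (hl : Even l.length) (hmem : ∀ a ∈ l, a.1 < m ∧ a.2 ∈ Finset.Icc 1 n)
    (hnodup : (l.map Prod.snd).Nodup) :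
    ∃ l' : List (ℕ × ℕ), l'.length = l.length ∧ (∀ a ∈ l', a.1 < m ∧ a.2 ∈ Finset.Icc 1 n) ∧
      (l'.map Prod.snd).Nodup ∧ m ∣ (l'.map Prod.fst).sum ∧ pinnacles l' = pinnacles l := by
  match l with
  | [] => exact absurd rfl hne
  | [a] => simp at hl
  | a :: b :: l =>
    obtain ⟨x, y, v, hperm, hpin, -⟩ := exists_remove_pinnacles_eq a b l
      (by simpa [Nat.even_add_one] using hl) hnodup
    let s := ((y :: v).map Prod.fst).sum
    obtain ⟨c, hc, hcs⟩ : ∃ c < m, m ∣ c + s := by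
      refine ⟨(m - s % m) % m, Nat.mod_lt _ hm, ?_⟩
      rw [Nat.dvd_iff_mod_eq_zero, Nat.mod_add_mod, ← Nat.add_mod_mod,
        Nat.sub_add_cancel (Nat.mod_lt _ hm).le, Nat.mod_self]
    obtain ⟨z, u, hperm', hpin', -⟩ := exists_insert_pinnacles_eq (c, x.2) y v
    refine ⟨z :: u, ?_, ?_, ?_, ?_, hpin'.trans hpin⟩
    · rw [hperm'.length_eq, ← hperm.length_eq]; rfl
    · intro q hq
      rcases List.mem_cons.mp (hperm'.mem_iff.mp hq) with rfl | hq
      · exact ⟨hc, (hmem x (hperm.mem_iff.mp (by simp))).2⟩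
      · exact hmem q (hperm.mem_iff.mp (List.mem_cons_of_mem _ hq))
    · rw [(hperm'.map _).nodup_iff]
      exact (hperm.map _).nodup_iff.mpr hnodup
    · rw [(hperm'.map _).sum_eq, List.map_cons, List.sum_cons]
      exact hcs

/-- For even `n = 2r`, `APS(m,p,2r) = APS(m,2r)`. -/
theorem APSc_eq_APS_even (m p r : ℕ) (hm : 1 ≤ m) (hp : 1 ≤ p) (hr : 1 ≤ r)
    (hpm : p ∣ m) :
    APSc m p (2 * r) ((2 * r - 1) / 2) = APS m (2 * r) ((2 * r - 1) / 2) := by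
  ext P
  refine and_congr_left fun _ => ⟨fun ⟨w, hw, _, hpin⟩ => ⟨w, hw, hpin⟩, ?_⟩
  rintro ⟨w, hw, rfl⟩
  have hlen : (wordList (2 * r) w).length = 2 * r := by simp [wordList]
  obtain ⟨hmem, hnodup⟩ := (isGenPerm_iff_wordList ..).mp hw
  obtain ⟨l, hl, hmem', hnodup', hsum, hpin⟩ := exists_dvd_sum_pinnacles_eq hm
    (List.ne_nil_of_length_pos (by omega)) (by simp [hlen]) hmem hnodup
  have hword := wordList_getD l
  rw [hl, hlen] at hword
  refine ⟨fun i => l.getD (i - 1) 0, ?_, ?_, ?_⟩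
  · rw [isGenPerm_iff_wordList, hword]
    exact ⟨hmem', hnodup'⟩
  · rw [← sum_wordList, hword]
    exact hpm.trans hsum
  · rw [← toFinset_pinnacles_wordList, ← toFinset_pinnacles_wordList, hword, hpin]
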